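/- Let m be a positive integer. There do not exist complex numbers c_0, c_1, …, c_{2m−1} such that Z_{2m}(s) + c_{2m−1}·Z_{2m−1}(s) + c_{2m−2}·Z_{2m−2}(s) + ⋯ + c_2·Z_2(s) + c_1·Z_1(s) + c_0·Z_0(s)/2 = 0 for every complex number s with Re(s) > 2. -/

import Mathlib

/-- The Euler–Zagier double zeta function `ζ(-c, s+c) = ∑_{m,n ≥ 1} m^c / (m+n)^(s+c)`. -/
noncomputable def Z (c : ℕ) (s : ℂ) : ℂ :=
  ∑' p : ℕ+ × ℕ+, ((p.1 : ℕ) : ℂ) ^ c / ((((p.1 : ℕ) + (p.2 : ℕ) : ℕ)) : ℂ) ^ (s + (c : ℂ))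

/-- The coefficients of `Z c` as an ordinary Dirichlet series. -/
noncomputable def coeffZ (c N : ℕ) : ℂ :=
  (∑ i ∈ Finset.Ico 1 N, (i : ℂ) ^ c) / (N : ℂ) ^ c

/-- The pairs of positive integers with sum `N` are parametrized by their first entry. -/
def icoEquivAddFiber (N : ℕ) :
    ↥(Finset.Ico 1 N) ≃ ((fun p : ℕ+ × ℕ+ => (p.1 : ℕ) + (p.2 : ℕ)) ⁻¹' {N}) where
  toFun i := ⟨(⟨i.1, (Finset.mem_Ico.1 i.2).1⟩,
      ⟨N - i.1, Nat.sub_pos_of_lt (Finset.mem_Ico.1 i.2).2⟩), by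
    have := Finset.mem_Ico.1 i.2
    simp only [Set.mem_preimage, PNat.mk_coe, Set.mem_singleton_iff]
    omega⟩
  invFun p := ⟨p.1.1, by
    have h : (p.1.1 : ℕ) + (p.1.2 : ℕ) = N := p.2
    have h1 := p.1.1.pos
    have h2 := p.1.2.pos
    rw [Finset.mem_Ico]
    omega⟩
  left_inv i := rfl
  right_inv p := by
    have h : (p.1.1 : ℕ) + (p.1.2 : ℕ) = N := p.2
    apply Subtype.ext
    refine Prod.ext rfl (PNat.eq ?_)
    simp only [PNat.mk_coe]
    omega

lemma norm_Z_summand_le (c : ℕ) {x : ℝ} (hx : 4 ≤ x) (p : ℕ+ × ℕ+) :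
    ‖((p.1 : ℕ) : ℂ) ^ c / ((((p.1 : ℕ) + (p.2 : ℕ) : ℕ)) : ℂ) ^ ((x : ℂ) + (c : ℂ))‖ ≤
      (1 / ((p.1 : ℕ) : ℝ) ^ 2) * (1 / ((p.2 : ℕ) : ℝ) ^ 2) := by
  have ha : (1 : ℝ) ≤ ((p.1 : ℕ) : ℝ) := by exact_mod_cast p.1.pos
  have hb : (1 : ℝ) ≤ ((p.2 : ℕ) : ℝ) := by exact_mod_cast p.2.pos
  rw [norm_div, norm_pow, Complex.norm_natCast,
    Complex.norm_natCast_cpow_of_pos (Nat.add_pos_left p.1.pos _)]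
  simp only [Complex.add_re, Complex.ofReal_re, Complex.natCast_re, Nat.cast_add]
  generalize ((p.1 : ℕ) : ℝ) = a at *
  generalize ((p.2 : ℕ) : ℝ) = b at *
  have hab : 1 ≤ a + b := by linarith
  have h4 : a ^ 2 * b ^ 2 ≤ (a + b) ^ x := by
    calc a ^ 2 * b ^ 2 ≤ (a + b) ^ 2 * (a + b) ^ 2 := by gcongr <;> linarith
      _ = (a + b) ^ (4 : ℝ) := by
        rw [← pow_add]
        exact_mod_cast (Real.rpow_natCast (a + b) 4).symm
      _ ≤ (a + b) ^ x := Real.rpow_le_rpow_of_exponent_le hab hx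
  have hc : a ^ c ≤ (a + b) ^ c := by gcongr; linarith
  rw [Real.rpow_add (by linarith), Real.rpow_natCast, div_mul_div_comm, one_mul,
    div_le_div_iff₀ (by positivity) (by positivity), one_mul]
  calc a ^ c * (a ^ 2 * b ^ 2) ≤ (a + b) ^ c * (a + b) ^ x := by gcongr
    _ = _ := mul_comm _ _

lemma summable_Z (c : ℕ) {x : ℝ} (hx : 4 ≤ x) :
    Summable fun p : ℕ+ × ℕ+ =>
      ((p.1 : ℕ) : ℂ) ^ c / ((((p.1 : ℕ) + (p.2 : ℕ) : ℕ)) : ℂ) ^ ((x : ℂ) + (c : ℂ)) := by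
  have h : Summable fun n : ℕ+ => 1 / ((n : ℕ) : ℝ) ^ 2 :=
    (Real.summable_one_div_nat_pow.2 one_lt_two).comp_injective PNat.coe_injective
  exact (h.mul_of_nonneg h (fun _ => by positivity) (fun _ => by positivity)).of_norm_bounded
    (norm_Z_summand_le c hx)

lemma lseriesHasSum_coeffZ (c : ℕ) {x : ℝ} (hx : 4 ≤ x) :
    LSeriesHasSum (coeffZ c) x (Z c x) := by
  have h := (summable_Z c hx).hasSum.tsum_fiberwise
    (fun p : ℕ+ × ℕ+ => (p.1 : ℕ) + (p.2 : ℕ))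
  rw [LSeriesHasSum, Z]
  refine h.congr_fun fun N => ?_
  rw [← (icoEquivAddFiber N).tsum_eq]
  rcases eq_or_ne N 0 with rfl | hN
  · rw [LSeries.term_zero, tsum_fintype]
    exact (Finset.sum_eq_zero fun i _ => absurd i.2 (by simp)).symm
  have hN' : (N : ℂ) ≠ 0 := Nat.cast_ne_zero.2 hN
  rw [LSeries.term_of_ne_zero hN, tsum_fintype, coeffZ, div_div, Finset.sum_div,
    ← Finset.sum_coe_sort]
  refine Finset.sum_congr rfl fun i _ => ?_
  have hi : ((icoEquivAddFiber N i).1.1 : ℕ) + ((icoEquivAddFiber N i).1.2 : ℕ) = N :=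
    (icoEquivAddFiber N i).2
  rw [hi, Complex.cpow_add _ _ hN', Complex.cpow_natCast, mul_comm]
  rfl

lemma bernoulli_two_mul_ne_zero {m : ℕ} (hm : m ≠ 0) : bernoulli (2 * m) ≠ 0 := by
  intro h
  have h1 := riemannZeta_two_mul_nat hm
  rw [h] at h1
  refine riemannZeta_ne_zero_of_one_le_re (s := 2 * m) ?_ (by simpa using h1)
  have : (1 : ℝ) ≤ m := by exact_mod_cast Nat.one_le_iff_ne_zero.2 hm
  simp
  linarith

open Polynomial in
/-- The polynomial whose value at `N` is `N ^ (d - 1) * coeffZ k N`, for `1 ≤ k ≤ d`. -/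
noncomputable def coeffZPoly (d k : ℕ) : ℂ[X] :=
  ∑ i ∈ Finset.range (k + 1),
    C ((bernoulli i : ℂ) * ((k + 1).choose i : ℂ) / ((k : ℂ) + 1)) * X ^ (d - i)

lemma sum_Ico_one_pow_eq {k : ℕ} (hk : k ≠ 0) (N : ℕ) :
    ∑ i ∈ Finset.Ico 1 N, (i : ℂ) ^ k =
      ∑ i ∈ Finset.range (k + 1),
        (bernoulli i : ℂ) * ((k + 1).choose i : ℂ) * (N : ℂ) ^ (k + 1 - i) / ((k : ℂ) + 1) := by
  have h : ∑ i ∈ Finset.range N, (i : ℂ) ^ k = ∑ i ∈ Finset.Ico 1 N, (i : ℂ) ^ k := by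
    rcases N with _ | N
    · simp
    · rw [Finset.range_eq_Ico, Finset.sum_eq_sum_Ico_succ_bot (Nat.succ_pos N)]
      simp [hk]
  rw [← h]
  have := congrArg (Rat.cast : ℚ → ℂ) (sum_range_pow N k)
  push_cast at this
  exact this

lemma eval_coeffZPoly {d k N : ℕ} (hk : k ≠ 0) (hkd : k ≤ d) (hN : N ≠ 0) :
    (coeffZPoly d k).eval (N : ℂ) * N = N ^ d * coeffZ k N := by
  have hN' : (N : ℂ) ≠ 0 := Nat.cast_ne_zero.2 hN
  rw [coeffZ, sum_Ico_one_pow_eq hk, coeffZPoly, Polynomial.eval_finsetSum, Finset.sum_mul,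
    ← mul_div_assoc, eq_div_iff (pow_ne_zero _ hN'), Finset.sum_mul, Finset.mul_sum]
  refine Finset.sum_congr rfl fun i hi => ?_
  have hik : i ≤ k := Nat.lt_succ_iff.1 (Finset.mem_range.1 hi)
  simp only [Polynomial.eval_mul, Polynomial.eval_C, Polynomial.eval_pow, Polynomial.eval_X]
  have e : (N : ℂ) ^ (d - i) * N * N ^ k = N ^ d * N ^ (k + 1 - i) := by
    rw [← pow_succ, ← pow_add, ← pow_add]
    congr 1
    omega
  linear_combination (bernoulli i : ℂ) * ((k + 1).choose i : ℂ) / ((k : ℂ) + 1) * e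

lemma eval_zero_coeffZPoly_of_lt {d k : ℕ} (hkd : k < d) : (coeffZPoly d k).eval 0 = 0 := by
  rw [coeffZPoly, Polynomial.eval_finsetSum]
  refine Finset.sum_eq_zero fun i hi => ?_
  have : d - i ≠ 0 := by have := Finset.mem_range.1 hi; omega
  simp [this]

lemma eval_zero_coeffZPoly_self (d : ℕ) : (coeffZPoly d d).eval 0 = (bernoulli d : ℂ) := by
  have hd : (d : ℂ) + 1 ≠ 0 := Nat.cast_add_one_ne_zero d
  rw [coeffZPoly, Polynomial.eval_finsetSum, Finset.sum_range_succ, Finset.sum_eq_zero, zero_add]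
  · simp [hd]
  · intro i hi
    have : d - i ≠ 0 := by have := Finset.mem_range.1 hi; omega
    simp [this]

lemma coeffZ_zero {N : ℕ} (hN : N ≠ 0) : coeffZ 0 N = N - 1 := by
  simp [coeffZ, Nat.cast_sub (Nat.one_le_iff_ne_zero.2 hN)]

open Polynomial in
lemma not_coeffZ_relation {m : ℕ} (hm : 1 ≤ m) (c : ℕ → ℂ) :
    ¬ ∀ N : ℕ, N ≠ 0 → coeffZ (2 * m) N + (∑ k ∈ Finset.Icc 1 (2 * m - 1), c k * coeffZ k N) +
      c 0 / 2 * coeffZ 0 N = 0 := by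
  intro hA0
  set Q : ℂ[X] := coeffZPoly (2 * m) (2 * m) +
    (∑ k ∈ Finset.Icc 1 (2 * m - 1), C (c k) * coeffZPoly (2 * m) k) +
    C (c 0 / 2) * (X ^ (2 * m - 1) * (X - 1)) with hQ
  have hroot {N : ℕ} (hN : N ≠ 0) : Q.eval (N : ℂ) = 0 := by
    have hN' : (N : ℂ) ≠ 0 := Nat.cast_ne_zero.2 hN
    have h1 : Q.eval (N : ℂ) * N = N ^ (2 * m) * (coeffZ (2 * m) N +
        (∑ k ∈ Finset.Icc 1 (2 * m - 1), c k * coeffZ k N) + c 0 / 2 * coeffZ 0 N) := by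
      have hs : ∑ k ∈ Finset.Icc 1 (2 * m - 1), c k * (coeffZPoly (2 * m) k).eval (N : ℂ) * N =
          ∑ k ∈ Finset.Icc 1 (2 * m - 1), N ^ (2 * m) * (c k * coeffZ k N) := by
        refine Finset.sum_congr rfl fun k hk => ?_
        have hk := Finset.mem_Icc.1 hk
        linear_combination c k * eval_coeffZPoly (d := 2 * m) (k := k) (by omega) (by omega) hN
      have ht := eval_coeffZPoly (d := 2 * m) (k := 2 * m) (by omega) le_rfl hN
      have hp : (N : ℂ) ^ (2 * m) = N ^ (2 * m - 1) * N := by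
        rw [← pow_succ]; congr 1; omega
      simp only [hQ, eval_add, eval_mul, eval_C, eval_finsetSum, eval_pow, eval_X, eval_sub,
        eval_one, add_mul, mul_add, Finset.sum_mul, Finset.mul_sum, coeffZ_zero hN, ht, hs]
      rw [hp]
      ring
    rw [hA0 N hN, mul_zero] at h1
    exact (mul_eq_zero.1 h1).resolve_right hN'
  have hQ0 : Q = 0 := by
    refine Polynomial.eq_zero_of_infinite_isRoot _ (Set.Infinite.mono ?_
      (Set.infinite_range_of_injective
        (f := fun n : ℕ => ((n + 1 : ℕ) : ℂ)) fun a b h => by simpa using h))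
    rintro _ ⟨n, rfl⟩
    exact hroot n.succ_ne_zero
  have h0 : Q.eval 0 = (bernoulli (2 * m) : ℂ) := by
    have hs : ∑ k ∈ Finset.Icc 1 (2 * m - 1), c k * (coeffZPoly (2 * m) k).eval 0 = 0 := by
      refine Finset.sum_eq_zero fun k hk => ?_
      have hk := Finset.mem_Icc.1 hk
      rw [eval_zero_coeffZPoly_of_lt (by omega), mul_zero]
    have hm' : 2 * m - 1 ≠ 0 := by omega
    simp [hQ, eval_finsetSum, hs, eval_zero_coeffZPoly_self, hm']
  rw [hQ0, eval_zero] at h0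
  exact bernoulli_two_mul_ne_zero (Nat.one_le_iff_ne_zero.1 hm) (by exact_mod_cast h0.symm)

/-- For a positive integer `m`, there are no complex numbers `c_0, …, c_{2m-1}` with
`Z_{2m}(s) + ∑_{k=1}^{2m-1} c_k Z_k(s) + c_0 Z_0(s)/2 = 0` for all `s` with `Re s > 2`. -/
theorem no_relation_with_Z_even_top (m : ℕ) (hm : 1 ≤ m) :
    ¬ ∃ c : ℕ → ℂ, ∀ s : ℂ, 2 < s.re →
      Z (2 * m) s + (∑ k ∈ Finset.Icc 1 (2 * m - 1), c k * Z k s) + c 0 * Z 0 s / 2 = 0 := by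
  rintro ⟨c, hc⟩
  set A : ℕ → ℂ := coeffZ (2 * m) + (∑ k ∈ Finset.Icc 1 (2 * m - 1), c k • coeffZ k) +
    (c 0 / 2) • coeffZ 0 with hA
  have hsum (x : ℝ) (hx : 4 ≤ x) : LSeriesHasSum A x 0 := by
    rw [← hc x (by rw [Complex.ofReal_re]; linarith), mul_div_right_comm]
    have h := lseriesHasSum_coeffZ (x := x) (hx := hx)
    refine ((h _).add ?_).add ((h 0).smul _)
    have h2 := hasSum_sum (s := Finset.Icc 1 (2 * m - 1)) fun k _ => (h k).smul (c k)
    rw [LSeriesHasSum]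
    convert h2 using 1
    ext n
    rw [LSeries.term_sum_apply]
  have hA0 {N : ℕ} (hN : N ≠ 0) : A N = 0 := by
    refine LSeries.eq_of_LSeries_eventually_eq (f := A) (g := 0) ?_ ?_ ?_ hN
    · exact (hsum 4 le_rfl).LSeriesSummable.abscissaOfAbsConv_le.trans_lt (EReal.coe_lt_top _)
    · exact (LSeriesSummable_zero (s := 0)).abscissaOfAbsConv_le.trans_lt (EReal.coe_lt_top _)
    · filter_upwards [Filter.eventually_ge_atTop 4] with x hx
      rw [(hsum x hx).LSeries_eq, LSeries_zero, Pi.zero_apply]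
  refine not_coeffZ_relation hm c fun N hN => ?_
  simpa [hA] using hA0 hN
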